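/- Let N_t, N_r, P, Q, L, N_g be positive integers with N = PQ, L ≤ P, and N − N_t·P ≥ N_t·P. Let 0 ≤ i_0 < i_1 < ⋯ < i_{N_t−1} < Q be pilot indices, let l = Σ_{μ=0}^{N_t−1} e_Q^{i_μ} be the pilot location vector, and assume (1_Q − l)^T l^{(q)} > 0 for every q ∈ {1, …, Q−1}, where l^{(q)} is the q-cyclic-down-shift of l. Let each base sequence s̃_μ ∈ ℂ^P have all entries nonzero, and let the noise-free received vector at receive antenna ν be y_ν(ε) = √N · e^{2πiεN_g/N} · D_N(ε) · Σ_{μ=0}^{N_t−1} F_N^H · diag(F_N [I_L; 0_{(N−L)×L}] h^{(ν,μ)}) · Θ_{i_μ} s̃_μ, where h^{(ν,μ)} ∈ ℂ^L is the channel from transmit antenna μ to receive antenna ν. Define the estimation metric M(ε̃) = Σ_{ν=0}^{N_r−1} ‖ F̄ · D_N(−ε̃) · y_ν(ε) ‖², where F̄ = [Θ_{i_0}, Θ_{i_1}, …, Θ_{i_{N_t−1}}]^T F_N. Then for every collection of channel vectors with h^{(ν,μ)} ≠ 0_L for all ν, μ, and every true CFO ε ∈ (−⌊Q/2⌋, Q−⌊Q/2⌋],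 the value ε̃ = ε is the unique maximizer of M over ε̃ ∈ (−⌊Q/2⌋, Q−⌊Q/2⌋]; that is, M(ε̃) < M(ε) for every ε̃ in this interval with ε̃ ≠ ε. -/

import Mathlib

open Matrix

noncomputable section

/-- The `N × N` unitary DFT matrix, with entries
`[F_N]_{k,n} = N^{-1/2} e^{-2πikn/N}`. -/
def dftMatrix (N : ℕ) : Matrix (Fin N) (Fin N) ℂ :=
  Matrix.of fun k n : Fin N =>
    (Real.sqrt N : ℂ)⁻¹ *
      Complex.exp (-(2 * (Real.pi : ℂ) * Complex.I * (k : ℕ) * (n : ℕ)) / (N : ℕ))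

/-- The diagonal matrix `D_N(ε)` with diagonal entries `e^{2πiεn/N}`, `n = 0, …, N-1`. -/
def cfoDiag (N : ℕ) (ε : ℝ) : Matrix (Fin N) (Fin N) ℂ :=
  Matrix.diagonal fun n : Fin N =>
    Complex.exp (2 * (Real.pi : ℂ) * Complex.I * (ε : ℂ) * ((n : ℕ) : ℂ) / (N : ℂ))

/-- For `N = PQ` and `q < Q`, the `N × P` matrix
`Θ_q = [e_N^{q}, e_N^{q+Q}, …, e_N^{q+(P-1)Q}]`. -/
def ThetaMat (N P Q : ℕ) (q : Fin Q) : Matrix (Fin N) (Fin P) ℂ :=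
  Matrix.of fun k p => if (k : ℕ) = (q : ℕ) + (p : ℕ) * Q then 1 else 0

/-- Zero-padding of a length-`L` channel vector to length `N`:
the `N × L` matrix `[I_L; 0_{(N−L)×L}]` applied to `h`. -/
def padVec (N L : ℕ) (h : Fin L → ℂ) : Fin N → ℂ :=
  fun n => if hn : (n : ℕ) < L then h ⟨n, hn⟩ else 0

/-- Noise-free received vector at one receive antenna:
`y(ε) = √N e^{2πiεN_g/N} D_N(ε) Σ_μ F_Nᴴ diag(F_N [I_L;0] h^{(μ)}) Θ_{i_μ} s̃_μ`. -/
def recvVec (N P Q Nt L Ng : ℕ) (i : Fin Nt → Fin Q)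
    (s : Fin Nt → Fin P → ℂ) (h : Fin Nt → Fin L → ℂ) (ε : ℝ) : Fin N → ℂ :=
  ((Real.sqrt N : ℂ) *
      Complex.exp (2 * (Real.pi : ℂ) * Complex.I * (ε : ℂ) * (Ng : ℂ) / (N : ℂ))) •
    (cfoDiag N ε).mulVec
      (∑ μ : Fin Nt, (dftMatrix N)ᴴ.mulVec
        (fun k => (dftMatrix N).mulVec (padVec N L (h μ)) k *
          (ThetaMat N P Q (i μ)).mulVec (s μ) k))

/-- The matrix `F̄ = [Θ_{i_0}, Θ_{i_1}, …, Θ_{i_{N_t−1}}]ᵀ F_N`, of size `(N_t P) × N`. -/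
def FbarMat (N P Q Nt : ℕ) (i : Fin Nt → Fin Q) : Matrix (Fin Nt × Fin P) (Fin N) ℂ :=
  Matrix.of fun mp n => ((ThetaMat N P Q (i mp.1))ᵀ * dftMatrix N) mp.2 n

/-- The estimation metric `M(ε̃) = Σ_ν ‖F̄ D_N(−ε̃) y_ν(ε)‖²`. -/
def cfoMetric (N P Q Nt Nr L Ng : ℕ) (i : Fin Nt → Fin Q)
    (s : Fin Nt → Fin P → ℂ) (h : Fin Nr → Fin Nt → Fin L → ℂ) (ε εt : ℝ) : ℝ :=
  ∑ ν : Fin Nr, ∑ j : Fin Nt × Fin P,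
    ‖(FbarMat N P Q Nt i).mulVec
        ((cfoDiag N (-εt)).mulVec (recvVec N P Q Nt L Ng i s (h ν) ε)) j‖ ^ 2

/-- The pilot location vector `l = Σ_μ e_Q^{i_μ}`. -/
def pilotLoc (Nt Q : ℕ) (i : Fin Nt → Fin Q) : Fin Q → ℝ :=
  fun q => ∑ μ : Fin Nt, if q = i μ then 1 else 0

/-- The point `e^{2πix}` of the unit circle. -/
def phase (x : ℝ) : ℂ := Complex.exp (2 * (Real.pi : ℂ) * Complex.I * (x : ℂ))

lemma phase_add (x y : ℝ) : phase (x + y) = phase x * phase y := by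
  simp only [phase, ← Complex.exp_add]
  congr 1
  push_cast
  ring

lemma phase_ne_zero (x : ℝ) : phase x ≠ 0 := Complex.exp_ne_zero _

lemma norm_phase (x : ℝ) : ‖phase x‖ = 1 := by
  rw [phase, Complex.norm_exp]
  simp

lemma star_phase (x : ℝ) : star (phase x) = phase (-x) := by
  simp [phase, ← Complex.exp_conj, Complex.conj_ofNat]

lemma phase_pow (x : ℝ) (n : ℕ) : phase x ^ n = phase (x * n) := by
  simp only [phase, ← Complex.exp_nat_mul]
  congr 1
  push_cast
  ring

lemma phase_eq_one_iff (x : ℝ) : phase x = 1 ↔ ∃ n : ℤ, x = n := by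
  rw [phase, Complex.exp_eq_one_iff]
  refine exists_congr fun n => ?_
  have h2 : (2 * (Real.pi : ℂ) * Complex.I) ≠ 0 := Complex.two_pi_I_ne_zero
  rw [mul_comm (n : ℂ), mul_right_inj' h2]
  exact_mod_cast Iff.rfl

lemma phase_eq_phase_iff (x y : ℝ) : phase x = phase y ↔ ∃ n : ℤ, x - y = n := by
  rw [← phase_eq_one_iff, sub_eq_add_neg, phase_add]
  have h : phase y * phase (-y) = 1 := by
    rw [← phase_add]
    simp [phase]
  constructor
  · intro e
    rw [e, h]
  · intro e
    have := congrArg (· * phase y) e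
    simp only [one_mul, mul_assoc] at this
    rwa [mul_comm (phase (-y)), h, mul_one] at this

lemma dftMatrix_apply (N : ℕ) (k n : Fin N) :
    dftMatrix N k n = (Real.sqrt N : ℂ)⁻¹ * phase (-((k : ℕ) * (n : ℕ) / N)) := by
  simp only [dftMatrix, Matrix.of_apply, phase]
  congr 2
  push_cast
  ring

lemma cfoDiag_mulVec (N : ℕ) (ε : ℝ) (v : Fin N → ℂ) (n : Fin N) :
    (cfoDiag N ε).mulVec v n = phase (ε * (n : ℕ) / N) * v n := by
  simp only [cfoDiag, Matrix.mulVec_diagonal, phase]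
  congr 2
  push_cast
  ring

lemma inv_sqrt_mul_inv_sqrt (N : ℕ) :
    (Real.sqrt N : ℂ)⁻¹ * (Real.sqrt N : ℂ)⁻¹ = (N : ℂ)⁻¹ := by
  rw [← mul_inv, ← Complex.ofReal_mul, Real.mul_self_sqrt (Nat.cast_nonneg N)]
  simp

lemma sum_phase_mul_div (N : ℕ) (d : ℤ) (hd : d ≠ 0) (hd' : |d| < N) :
    ∑ n : Fin N, phase (d * (n : ℕ) / N) = 0 := by
  have hN : (N : ℝ) ≠ 0 := by
    have : (0 : ℤ) < N := (abs_nonneg d).trans_lt hd'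
    exact_mod_cast this.ne'
  have hpow : ∀ n : Fin N, phase (d * (n : ℕ) / N) = phase (d / N) ^ (n : ℕ) := fun n => by
    rw [phase_pow]
    congr 1
    ring
  have hne : phase (d / N) ≠ 1 := by
    rw [Ne, phase_eq_one_iff]
    rintro ⟨m, hm⟩
    rw [div_eq_iff hN] at hm
    have hm' : d = m * N := by exact_mod_cast hm
    exact hd (Int.eq_zero_of_abs_lt_dvd ⟨m, by rw [hm', mul_comm]⟩ hd')
  have hone : phase (d / N) ^ N = 1 := by
    rw [phase_pow, phase_eq_one_iff]
    exact ⟨d, by field_simp⟩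
  simp_rw [hpow]
  rw [Fin.sum_univ_eq_sum_range (fun n => phase (d / N) ^ n) N, geom_sum_eq hne, hone]
  simp

lemma dftMatrix_mul_conjTranspose (N : ℕ) : dftMatrix N * (dftMatrix N)ᴴ = 1 := by
  ext j k
  have hN : (N : ℂ) ≠ 0 := by
    have : 0 < N := j.pos
    exact_mod_cast this.ne'
  have hterm : ∀ n : Fin N, dftMatrix N j n * (dftMatrix N)ᴴ n k =
      (N : ℂ)⁻¹ * phase ((((k : ℕ) : ℤ) - ((j : ℕ) : ℤ) : ℤ) * (n : ℕ) / N) := fun n => by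
    rw [Matrix.conjTranspose_apply, dftMatrix_apply, dftMatrix_apply, star_mul', star_phase,
      ← inv_sqrt_mul_inv_sqrt]
    have : star ((Real.sqrt N : ℂ)⁻¹) = (Real.sqrt N : ℂ)⁻¹ := by simp
    rw [this, mul_mul_mul_comm, ← phase_add]
    congr 2
    push_cast
    ring
  rw [Matrix.mul_apply, Finset.sum_congr rfl fun n _ => hterm n, ← Finset.mul_sum]
  by_cases hjk : j = k
  · subst hjk
    simp [phase, hN]
  · rw [sum_phase_mul_div, mul_zero, Matrix.one_apply_ne hjk]
    · have := Fin.val_ne_of_ne hjk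
      omega
    · rw [abs_lt]
      omega

lemma conjTranspose_mul_dftMatrix (N : ℕ) : (dftMatrix N)ᴴ * dftMatrix N = 1 :=
  mul_eq_one_comm.mp (dftMatrix_mul_conjTranspose N)

lemma sum_norm_sq_eq_dotProduct {n : Type*} [Fintype n] (v : n → ℂ) :
    ((∑ k, ‖v k‖ ^ 2 : ℝ) : ℂ) = star v ⬝ᵥ v := by
  simp [Complex.conj_mul', dotProduct]

/-- The Parseval identity. -/
lemma sum_norm_sq_dftMatrix_mulVec (N : ℕ) (v : Fin N → ℂ) :
    ∑ k, ‖(dftMatrix N).mulVec v k‖ ^ 2 = ∑ n, ‖v n‖ ^ 2 := by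
  have h : ((∑ k, ‖(dftMatrix N).mulVec v k‖ ^ 2 : ℝ) : ℂ) = ((∑ n, ‖v n‖ ^ 2 : ℝ) : ℂ) := by
    rw [sum_norm_sq_eq_dotProduct, sum_norm_sq_eq_dotProduct, Matrix.star_mulVec,
      ← Matrix.dotProduct_mulVec, Matrix.mulVec_mulVec, conjTranspose_mul_dftMatrix,
      Matrix.one_mulVec]
  exact_mod_cast h

/-- If two exponential sums with nodes in a set of at most `Q` points agree on `Q` consecutive
exponents, then the coefficient at a node occurring only once vanishes. -/
lemma coeff_eq_zero_of_sum_pow_eq {ι K : Type*} [Fintype ι] [Field K] [DecidableEq K]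
    {Q : ℕ} (W : Finset K) (hW : W.card ≤ Q) (a b x y : ι → K) (j : ι)
    (ha : ∀ μ, a μ ∈ W) (hb : ∀ μ, b μ ∈ W) (haj : ∀ μ, μ ≠ j → a μ ≠ a j)
    (hbj : ∀ μ, b μ ≠ a j)
    (hsum : ∀ m < Q, ∑ μ, x μ * a μ ^ m = ∑ μ, y μ * b μ ^ m) : x j = 0 := by
  classical
  set p : Polynomial K := ∏ w ∈ W.erase (a j), (Polynomial.X - Polynomial.C w) with hp
  have hdeg : p.natDegree < Q := by
    rw [hp, Polynomial.natDegree_finsetProd_X_sub_C_eq_card]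
    exact (Finset.card_erase_lt_of_mem (ha j)).trans_le hW
  have hroot : ∀ w ∈ W, w ≠ a j → p.eval w = 0 := fun w hw hne => by
    rw [hp, Polynomial.eval_prod]
    exact Finset.prod_eq_zero (Finset.mem_erase.2 ⟨hne, hw⟩) (by simp)
  have hnz : p.eval (a j) ≠ 0 := by
    rw [hp, Polynomial.eval_prod, Finset.prod_ne_zero_iff]
    intro w hw
    simpa [sub_eq_zero] using (Finset.ne_of_mem_erase hw).symm
  have hexp : ∀ c d : ι → K, ∑ μ, c μ * p.eval (d μ) =
      ∑ m ∈ Finset.range Q, p.coeff m * ∑ μ, c μ * d μ ^ m := fun c d => by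
    simp_rw [Polynomial.eval_eq_sum_range' hdeg, Finset.mul_sum]
    rw [Finset.sum_comm]
    exact Finset.sum_congr rfl fun m _ => Finset.sum_congr rfl fun μ _ => by ring
  have hxy : ∑ μ, x μ * p.eval (a μ) = ∑ μ, y μ * p.eval (b μ) := by
    rw [hexp, hexp]
    exact Finset.sum_congr rfl fun m hm => by rw [hsum m (Finset.mem_range.1 hm)]
  rw [Finset.sum_eq_single j (fun μ _ hμ => by rw [hroot _ (ha μ) (haj μ hμ), mul_zero])
    (by simp), Finset.sum_eq_zero fun μ _ => by rw [hroot _ (hb μ) (hbj μ), mul_zero]] at hxy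
  exact (mul_eq_zero.1 hxy).resolve_right hnz

lemma phase_div_eq_phase_div_iff {Q : ℕ} (hQ : 0 < Q) (x y : ℝ) :
    phase (x / Q) = phase (y / Q) ↔ ∃ n : ℤ, x - y = n * Q := by
  rw [phase_eq_phase_iff]
  have : (Q : ℝ) ≠ 0 := by exact_mod_cast hQ.ne'
  refine exists_congr fun n => ?_
  rw [← sub_div, div_eq_iff this]

lemma phase_natCast_div_injective {Q : ℕ} {k l : ℕ} (hk : k < Q) (hl : l < Q)
    (h : phase (k / Q) = phase (l / Q)) : k = l := by
  obtain ⟨n, hn⟩ := (phase_div_eq_phase_div_iff (by omega) _ _).1 h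
  have hn' : (k : ℤ) - l = n * Q := by exact_mod_cast hn
  have : (k : ℤ) - l = 0 :=
    Int.eq_zero_of_abs_lt_dvd ⟨n, by rw [hn', mul_comm]⟩ (by rw [abs_lt]; omega)
  omega

/-- The shift condition on the pilot location vector yields a pilot whose `q`-shift is
not a pilot. -/
lemma exists_shift_notMem_range {Nt Q : ℕ} (i : Fin Nt → Fin Q) (q : Fin Q)
    (h : 0 < ∑ k : Fin Q, (1 - pilotLoc Nt Q i k) * pilotLoc Nt Q i (k - q)) :
    ∃ (j : Fin Nt) (k : Fin Q), k - q = i j ∧ ∀ μ, k ≠ i μ := by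
  have hnonneg : ∀ k, 0 ≤ pilotLoc Nt Q i k := fun k =>
    Finset.sum_nonneg fun μ _ => by split_ifs <;> norm_num
  obtain ⟨k, -, hk⟩ := Finset.exists_lt_of_sum_lt (s := Finset.univ) (f := fun _ : Fin Q => (0 : ℝ))
    (by simpa using h)
  have hpos : 0 < pilotLoc Nt Q i (k - q) :=
    (hnonneg _).lt_of_ne fun h0 => by simp [← h0] at hk
  have hlt : pilotLoc Nt Q i k < 1 := by
    have := pos_of_mul_pos_left hk hpos.le
    linarith
  obtain ⟨j, -, hj⟩ := Finset.exists_ne_zero_of_sum_ne_zero hpos.ne'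
  refine ⟨j, k, by_contra fun hne => hj (if_neg hne), fun μ hμ => hlt.not_ge ?_⟩
  have := Finset.single_le_sum (f := fun μ => if k = i μ then (1 : ℝ) else 0)
    (fun μ _ => by split_ifs <;> norm_num) (Finset.mem_univ μ)
  rw [if_pos hμ] at this
  exact this

/-- For a nonzero frequency offset `δ` with `|δ| < Q`, some shifted pilot node differs from
all pilot nodes, and all nodes lie in a set of at most `Q` points. -/
lemma exists_separated_node {Nt Q : ℕ} (hNt : 0 < Nt) (hQ : 2 * Nt ≤ Q) (i : Fin Nt → Fin Q)
    (hshift : ∀ q : Fin Q, (q : ℕ) ≠ 0 →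
      0 < ∑ k : Fin Q, (1 - pilotLoc Nt Q i k) * pilotLoc Nt Q i (k - q))
    (δ : ℝ) (hδ : δ ≠ 0) (hδ' : |δ| < Q) :
    ∃ (j : Fin Nt) (W : Finset ℂ), W.card ≤ Q ∧
      (∀ μ, phase (((i μ : ℕ) + δ) / Q) ∈ W) ∧ (∀ μ, phase ((i μ : ℕ) / Q) ∈ W) ∧
      ∀ μ, phase ((i μ : ℕ) / Q) ≠ phase (((i j : ℕ) + δ) / Q) := by
  classical
  have hQ0 : 0 < Q := by omega
  by_cases hint : ∃ d : ℤ, δ = d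
  · obtain ⟨d, rfl⟩ := hint
    have hd : d ≠ 0 := by exact_mod_cast hδ
    have hd' : |d| < Q := by exact_mod_cast hδ'
    have hrep : ∀ t : ℤ, ∃ k : Fin Q, ∃ n : ℤ, ((k : ℕ) : ℤ) = t - n * Q := fun t => by
      have h1 := Int.emod_nonneg t (b := Q) (by omega)
      have h2 := Int.emod_lt_of_pos t (b := Q) (by omega)
      refine ⟨⟨(t % Q).toNat, by omega⟩, t / Q, ?_⟩
      have := Int.emod_add_mul_ediv t Q
      simp only [Int.toNat_of_nonneg h1]
      linarith
    obtain ⟨q, c, hq⟩ := hrep d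
    have hq0 : (q : ℕ) ≠ 0 := fun h0 => hd
      (Int.eq_zero_of_abs_lt_dvd ⟨c, by rw [h0] at hq; push_cast at hq; linarith⟩ hd')
    obtain ⟨j, k, hkj, hk⟩ := exists_shift_notMem_range i q (hshift q hq0)
    refine ⟨j, Finset.univ.image fun k : Fin Q => phase ((k : ℕ) / Q), ?_, ?_, ?_, ?_⟩
    · exact Finset.card_image_le.trans (by simp)
    · intro μ
      obtain ⟨k, n, hkn⟩ := hrep ((i μ : ℕ) + d)
      refine Finset.mem_image.2 ⟨k, Finset.mem_univ _, ?_⟩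
      rw [phase_div_eq_phase_div_iff hQ0]
      refine ⟨-n, ?_⟩
      have : ((k : ℕ) : ℝ) = (i μ : ℕ) + d - n * Q := by exact_mod_cast hkn
      rw [this]
      push_cast
      ring
    · exact fun μ => Finset.mem_image_of_mem _ (Finset.mem_univ _)
    · intro μ hμ
      obtain ⟨n, hn⟩ := (phase_div_eq_phase_div_iff hQ0 _ _).1 hμ
      have hn' : ((i μ : ℕ) : ℤ) - ((i j : ℕ) + d) = n * Q := by exact_mod_cast hn
      have hsub : ∃ e : ℤ, ((i j : ℕ) : ℤ) = (k : ℕ) - (q : ℕ) + e * Q := by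
        rw [← hkj, Fin.sub_def]
        refine ⟨1 - ((Q - (q : ℕ) + (k : ℕ) : ℕ) : ℤ) / Q, ?_⟩
        have := Int.emod_add_mul_ediv ((Q - (q : ℕ) + (k : ℕ) : ℕ) : ℤ) Q
        push_cast [Nat.cast_sub q.isLt.le] at this ⊢
        linarith
      obtain ⟨e, he⟩ := hsub
      refine hk μ (Fin.ext ?_)
      have : ((k : ℕ) : ℤ) - (i μ : ℕ) = 0 := by
        refine Int.eq_zero_of_abs_lt_dvd (m := Q) ⟨-n - e - c, ?_⟩ (by rw [abs_lt]; omega)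
        linear_combination -hn' - he + hq
      omega
  · refine ⟨⟨0, hNt⟩, (Finset.univ.image fun μ => phase (((i μ : ℕ) + δ) / Q)) ∪
      Finset.univ.image fun μ => phase ((i μ : ℕ) / Q), ?_, ?_, ?_, ?_⟩
    · refine (Finset.card_union_le _ _).trans ((add_le_add Finset.card_image_le
        Finset.card_image_le).trans ?_)
      simp only [Finset.card_univ, Fintype.card_fin]
      omega
    · exact fun μ => Finset.mem_union_left _ (Finset.mem_image_of_mem _ (Finset.mem_univ _))
    · exact fun μ => Finset.mem_union_right _ (Finset.mem_image_of_mem _ (Finset.mem_univ _))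
    · intro μ hμ
      obtain ⟨n, hn⟩ := (phase_div_eq_phase_div_iff hQ0 _ _).1 hμ
      refine hint ⟨(i μ : ℕ) - (i ⟨0, hNt⟩ : ℕ) - n * Q, ?_⟩
      push_cast
      linarith

/-- The subcarrier `i_μ + pQ`. -/
def pilotIdx {Nt P Q : ℕ} (i : Fin Nt → Fin Q) (j : Fin Nt × Fin P) : Fin (P * Q) :=
  finProdFinEquiv (j.2, i j.1)

lemma pilotIdx_val {Nt P Q : ℕ} (i : Fin Nt → Fin Q) (j : Fin Nt × Fin P) :
    (pilotIdx i j : ℕ) = i j.1 + Q * j.2 := rfl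

lemma pilotIdx_injective {Nt P Q : ℕ} {i : Fin Nt → Fin Q} (hi : Function.Injective i) :
    Function.Injective (pilotIdx (P := P) i) := by
  rintro ⟨μ, p⟩ ⟨μ', p'⟩ h
  have := finProdFinEquiv.injective h
  simp only [Prod.mk.injEq] at this
  rw [this.1, hi this.2]

lemma ThetaMat_apply {Nt P Q : ℕ} (i : Fin Nt → Fin Q) (μ : Fin Nt) (k : Fin (P * Q))
    (p : Fin P) : ThetaMat (P * Q) P Q (i μ) k p = if k = pilotIdx i (μ, p) then 1 else 0 := by
  simp only [ThetaMat, Matrix.of_apply, Fin.ext_iff, pilotIdx_val, mul_comm Q]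

lemma FbarMat_mulVec {Nt P Q : ℕ} (i : Fin Nt → Fin Q) (v : Fin (P * Q) → ℂ)
    (j : Fin Nt × Fin P) :
    (FbarMat (P * Q) P Q Nt i).mulVec v j = (dftMatrix (P * Q)).mulVec v (pilotIdx i j) := by
  have : ∀ n, FbarMat (P * Q) P Q Nt i j n = dftMatrix (P * Q) (pilotIdx i j) n := fun n => by
    simp [FbarMat, Matrix.mul_apply, ThetaMat_apply]
  simp [Matrix.mulVec, dotProduct, this]

/-- The frequency-domain signal `Σ_μ diag(F_N [I_L;0] h^{(μ)}) Θ_{i_μ} s̃_μ`. -/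
def freqSignal {Nt P Q L : ℕ} (i : Fin Nt → Fin Q) (s : Fin Nt → Fin P → ℂ)
    (h : Fin Nt → Fin L → ℂ) : Fin (P * Q) → ℂ := fun k =>
  ∑ μ, (dftMatrix (P * Q)).mulVec (padVec (P * Q) L (h μ)) k *
    (ThetaMat (P * Q) P Q (i μ)).mulVec (s μ) k

lemma freqSignal_eq_zero {Nt P Q L : ℕ} (i : Fin Nt → Fin Q) (s : Fin Nt → Fin P → ℂ)
    (h : Fin Nt → Fin L → ℂ) (k : Fin (P * Q)) (hk : k ∉ Set.range (pilotIdx (P := P) i)) :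
    freqSignal i s h k = 0 := by
  refine Finset.sum_eq_zero fun μ _ => ?_
  have : (ThetaMat (P * Q) P Q (i μ)).mulVec (s μ) k = 0 := by
    rw [Matrix.mulVec, dotProduct]
    refine Finset.sum_eq_zero fun p _ => ?_
    rw [ThetaMat_apply, if_neg fun e => hk ⟨_, e.symm⟩, zero_mul]
  rw [this, mul_zero]

lemma freqSignal_pilotIdx {Nt P Q L : ℕ} {i : Fin Nt → Fin Q} (hi : Function.Injective i)
    (s : Fin Nt → Fin P → ℂ) (h : Fin Nt → Fin L → ℂ) (μ : Fin Nt) (p : Fin P) :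
    freqSignal i s h (pilotIdx i (μ, p)) =
      (dftMatrix (P * Q)).mulVec (padVec (P * Q) L (h μ)) (pilotIdx i (μ, p)) * s μ p := by
  have hTheta : ∀ μ', (ThetaMat (P * Q) P Q (i μ')).mulVec (s μ') (pilotIdx i (μ, p)) =
      if μ' = μ then s μ p else 0 := fun μ' => by
    simp only [Matrix.mulVec, dotProduct, ThetaMat_apply, (pilotIdx_injective hi).eq_iff,
      Prod.mk.injEq]
    by_cases hμ : μ' = μ
    · subst hμ
      simp
    · simp [hμ, Ne.symm hμ]
  simp [freqSignal, hTheta]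

/-- Samples of a signal supported on the pilot subcarriers, along a progression of step `P`. -/
lemma conjTranspose_dftMatrix_mulVec_apply {Nt P Q : ℕ} (hP : 0 < P) (hQ : 0 < Q)
    {i : Fin Nt → Fin Q} (hi : Function.Injective i) (X : Fin (P * Q) → ℂ)
    (hX : ∀ k ∉ Set.range (pilotIdx (P := P) i), X k = 0) (t : Fin (P * Q)) (n m : ℕ)
    (ht : (t : ℕ) = n + P * m) :
    (dftMatrix (P * Q))ᴴ.mulVec X t = (Real.sqrt (P * Q : ℕ) : ℂ)⁻¹ *
      ∑ μ, (∑ p : Fin P, phase ((pilotIdx i (μ, p) : ℕ) * n / (P * Q : ℕ)) *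
        X (pilotIdx i (μ, p))) * phase ((i μ : ℕ) / Q) ^ m := by
  have hentry : ∀ k, (dftMatrix (P * Q))ᴴ t k * X k = (Real.sqrt (P * Q : ℕ) : ℂ)⁻¹ *
      (phase ((k : ℕ) * (t : ℕ) / (P * Q : ℕ)) * X k) := fun k => by
    rw [Matrix.conjTranspose_apply, dftMatrix_apply, star_mul', star_phase, neg_neg, ← mul_assoc]
    congr 2
    simp
  rw [Matrix.mulVec, dotProduct, Finset.sum_congr rfl fun k _ => hentry k, ← Finset.mul_sum]
  congr 1
  rw [← Fintype.sum_of_injective (pilotIdx i) (pilotIdx_injective hi)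
    (fun j => phase ((pilotIdx i j : ℕ) * (t : ℕ) / (P * Q : ℕ)) * X (pilotIdx i j)) _
    (fun k hk => by rw [hX k hk, mul_zero]) (fun _ => rfl), Fintype.sum_prod_type]
  refine Finset.sum_congr rfl fun μ _ => ?_
  rw [Finset.sum_mul]
  refine Finset.sum_congr rfl fun p _ => ?_
  rw [mul_right_comm, phase_pow, ← phase_add]
  congr 1
  rw [phase_eq_phase_iff]
  refine ⟨(p : ℕ) * m, ?_⟩
  have hP' : (P : ℝ) ≠ 0 := by exact_mod_cast hP.ne'
  have hQ' : (Q : ℝ) ≠ 0 := by exact_mod_cast hQ.ne'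
  rw [ht, pilotIdx_val]
  push_cast
  field_simp
  ring

/-- The values on a coset of subcarriers of the frequency response of a nonzero channel
of length at most `P` are not all zero. -/
lemma exists_dftMatrix_padVec_ne_zero {Nt P Q L : ℕ} (hQ : 0 < Q) (hLP : L ≤ P)
    (i : Fin Nt → Fin Q) (μ : Fin Nt) (h : Fin L → ℂ) (hh : h ≠ 0) :
    ∃ p : Fin P,
      (dftMatrix (P * Q)).mulVec (padVec (P * Q) L h) (pilotIdx i (μ, p)) ≠ 0 := by
  by_contra! hzero
  have hLN : L ≤ P * Q := hLP.trans (Nat.le_mul_of_pos_right P hQ)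
  refine hh (Matrix.eq_zero_of_forall_index_sum_pow_mul_eq_zero
    (f := fun l : Fin L => phase (-((pilotIdx i (μ, Fin.castLE hLP l) : ℕ) / (P * Q : ℕ))))
    ?_ fun l => ?_)
  · intro l l' hl
    have hl' := congrArg star hl
    simp only [star_phase, neg_neg] at hl'
    have := phase_natCast_div_injective (Fin.is_lt _) (Fin.is_lt _) hl'
    rw [pilotIdx_val, pilotIdx_val] at this
    have := Nat.eq_of_mul_eq_mul_left hQ (Nat.add_left_cancel this)
    exact Fin.ext this
  · have h0 := hzero (Fin.castLE hLP l)
    rw [Matrix.mulVec, dotProduct, ← Fintype.sum_of_injective (Fin.castLE hLN)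
      (Fin.castLE_injective hLN) (fun n => (Real.sqrt (P * Q : ℕ) : ℂ)⁻¹ *
        (phase (-((pilotIdx i (μ, Fin.castLE hLP l) : ℕ) / (P * Q : ℕ))) ^ (n : ℕ) * h n))
      _ ?_ ?_, ← Finset.mul_sum] at h0
    · refine (mul_eq_zero.1 h0).resolve_left (inv_ne_zero ?_)
      have : 0 < P * Q := (Fin.castLE hLN l).pos
      rw [Complex.ofReal_ne_zero, Real.sqrt_ne_zero']
      exact_mod_cast this
    · intro n hn
      rw [padVec, dif_neg fun hnL => hn ⟨⟨n, hnL⟩, rfl⟩, mul_zero]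
    · intro n
      rw [dftMatrix_apply, phase_pow, padVec, dif_pos (by simp), mul_assoc]
      congr 3
      simp only [Fin.val_castLE]
      ring

/-- A nonzero frequency offset `δ` with `|δ| < Q` leaks energy outside the pilot subcarriers. -/
lemma exists_leakage {Nt P Q L : ℕ} (hNt : 0 < Nt) (hP : 0 < P) (hQ : 2 * Nt ≤ Q)
    (hLP : L ≤ P) {i : Fin Nt → Fin Q} (hi : Function.Injective i)
    (hshift : ∀ q : Fin Q, (q : ℕ) ≠ 0 →
      0 < ∑ k : Fin Q, (1 - pilotLoc Nt Q i k) * pilotLoc Nt Q i (k - q))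
    (s : Fin Nt → Fin P → ℂ) (hs : ∀ μ p, s μ p ≠ 0)
    (h : Fin Nt → Fin L → ℂ) (hh : ∀ μ, h μ ≠ 0)
    (δ : ℝ) (hδ : δ ≠ 0) (hδ' : |δ| < Q) :
    ∃ k ∉ Set.range (pilotIdx (P := P) i), (dftMatrix (P * Q)).mulVec
      ((cfoDiag (P * Q) δ).mulVec ((dftMatrix (P * Q))ᴴ.mulVec (freqSignal i s h))) k ≠ 0 := by
  classical
  by_contra! hzero
  have hQ0 : 0 < Q := by omega
  have hP' : (P : ℝ) ≠ 0 := by exact_mod_cast hP.ne'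
  have hQ' : (Q : ℝ) ≠ 0 := by exact_mod_cast hQ0.ne'
  set X := freqSignal i s h with hX
  set z := (cfoDiag (P * Q) δ).mulVec ((dftMatrix (P * Q))ᴴ.mulVec X) with hz
  set Z := (dftMatrix (P * Q)).mulVec z with hZ
  have hzZ : (dftMatrix (P * Q))ᴴ.mulVec Z = z := by
    rw [hZ, Matrix.mulVec_mulVec, conjTranspose_mul_dftMatrix, Matrix.one_mulVec]
  obtain ⟨j, W, hW, haW, hbW, hsep⟩ := exists_separated_node hNt hQ i hshift δ hδ hδ'
  have hsqrt : (Real.sqrt (P * Q : ℕ) : ℂ)⁻¹ ≠ 0 := by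
    refine inv_ne_zero ?_
    rw [Complex.ofReal_ne_zero, Real.sqrt_ne_zero']
    exact_mod_cast Nat.mul_pos hP hQ0
  have htime : ∀ n : Fin P, ∑ p : Fin P,
      phase ((pilotIdx i (j, p) : ℕ) * (n : ℕ) / (P * Q : ℕ)) * X (pilotIdx i (j, p)) = 0 := by
    intro n
    have hcoeff := coeff_eq_zero_of_sum_pow_eq W hW (fun μ => phase (((i μ : ℕ) + δ) / Q))
      (fun μ => phase ((i μ : ℕ) / Q))
      (fun μ => phase (δ * (n : ℕ) / (P * Q : ℕ)) * ∑ p : Fin P,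
        phase ((pilotIdx i (μ, p) : ℕ) * (n : ℕ) / (P * Q : ℕ)) * X (pilotIdx i (μ, p)))
      (fun μ => ∑ p : Fin P,
        phase ((pilotIdx i (μ, p) : ℕ) * (n : ℕ) / (P * Q : ℕ)) * Z (pilotIdx i (μ, p)))
      j haW hbW ?_ hsep ?_
    · exact (mul_eq_zero.1 hcoeff).resolve_left (phase_ne_zero _)
    · intro μ hμ heq
      obtain ⟨c, hc⟩ := (phase_div_eq_phase_div_iff hQ0 _ _).1 heq
      refine hμ (hi (Fin.ext (phase_natCast_div_injective (i μ).isLt (i j).isLt ?_)))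
      exact (phase_div_eq_phase_div_iff hQ0 _ _).2 ⟨c, by linarith⟩
    · intro m hm
      have hlt : (n : ℕ) + P * m < P * Q := by
        have := Nat.mul_le_mul_left P (Nat.succ_le_of_lt hm)
        rw [Nat.mul_succ] at this
        have := n.isLt
        omega
      have ht := congrFun hzZ ⟨n + P * m, hlt⟩
      rw [hz, cfoDiag_mulVec,
        conjTranspose_dftMatrix_mulVec_apply hP hQ0 hi Z hzero ⟨n + P * m, hlt⟩ n m rfl,
        conjTranspose_dftMatrix_mulVec_apply hP hQ0 hi X (freqSignal_eq_zero i s h)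
          ⟨n + P * m, hlt⟩ n m rfl, mul_left_comm, mul_right_inj' hsqrt] at ht
      rw [ht, Finset.mul_sum]
      refine Finset.sum_congr rfl fun μ _ => ?_
      have hphase : phase (((i μ : ℕ) + δ) / Q) ^ m * phase (δ * (n : ℕ) / (P * Q : ℕ)) =
          phase (δ * (n + P * m : ℕ) / (P * Q : ℕ)) * phase ((i μ : ℕ) / Q) ^ m := by
        rw [phase_pow, phase_pow, ← phase_add, ← phase_add]
        congr 1
        push_cast
        field_simp
        ring
      linear_combination (∑ p : Fin P, phase ((pilotIdx i (μ, p) : ℕ) * (n : ℕ) / (P * Q : ℕ)) *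
        X (pilotIdx i (μ, p))) * hphase
  have hXzero : (fun p : Fin P => X (pilotIdx i (j, p))) = 0 := by
    refine Matrix.eq_zero_of_forall_pow_sum_mul_pow_eq_zero
      (f := fun p => phase ((pilotIdx i (j, p) : ℕ) / (P * Q : ℕ))) ?_ fun n => ?_
    · intro p p' hp
      have := phase_natCast_div_injective (Fin.is_lt _) (Fin.is_lt _) hp
      exact congrArg Prod.snd (pilotIdx_injective hi (Fin.ext this))
    · rw [← htime n]
      refine Finset.sum_congr rfl fun p _ => ?_
      rw [phase_pow, mul_comm]
      congr 2
      ring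
  obtain ⟨p, hp⟩ := exists_dftMatrix_padVec_ne_zero hQ0 hLP i j (h j) (hh j)
  have := congrFun hXzero p
  simp only [hX, freqSignal_pilotIdx hi, Pi.zero_apply] at this
  exact mul_ne_zero hp (hs j p) this

lemma FbarMat_mulVec_recvVec {Nt P Q L : ℕ} (Ng : ℕ) (i : Fin Nt → Fin Q)
    (s : Fin Nt → Fin P → ℂ) (h : Fin Nt → Fin L → ℂ) (ε εt : ℝ) (j : Fin Nt × Fin P) :
    ‖(FbarMat (P * Q) P Q Nt i).mulVec ((cfoDiag (P * Q) (-εt)).mulVec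
      (recvVec (P * Q) P Q Nt L Ng i s h ε)) j‖ ^ 2 = (P * Q : ℕ) *
    ‖(dftMatrix (P * Q)).mulVec ((cfoDiag (P * Q) (ε - εt)).mulVec
      ((dftMatrix (P * Q))ᴴ.mulVec (freqSignal i s h))) (pilotIdx i j)‖ ^ 2 := by
  have hrecv : (cfoDiag (P * Q) (-εt)).mulVec (recvVec (P * Q) P Q Nt L Ng i s h ε) =
      ((Real.sqrt (P * Q : ℕ) : ℂ) * phase (ε * Ng / (P * Q : ℕ))) •
        (cfoDiag (P * Q) (ε - εt)).mulVec
          ((dftMatrix (P * Q))ᴴ.mulVec (freqSignal i s h)) := by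
    have hsum : (∑ μ : Fin Nt, (dftMatrix (P * Q))ᴴ.mulVec
        (fun k => (dftMatrix (P * Q)).mulVec (padVec (P * Q) L (h μ)) k *
          (ThetaMat (P * Q) P Q (i μ)).mulVec (s μ) k)) =
        (dftMatrix (P * Q))ᴴ.mulVec (freqSignal i s h) := by
      rw [← Matrix.mulVec_sum]
      congr 1
      ext k
      simp [freqSignal]
    have hconst : Complex.exp (2 * (Real.pi : ℂ) * Complex.I * (ε : ℂ) * (Ng : ℂ) /
        ((P * Q : ℕ) : ℂ)) = phase (ε * Ng / (P * Q : ℕ)) := by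
      rw [phase]
      congr 1
      push_cast
      ring
    rw [recvVec, hsum, hconst, Matrix.mulVec_smul]
    congr 1
    ext n
    rw [cfoDiag_mulVec, cfoDiag_mulVec, cfoDiag_mulVec, ← mul_assoc, ← phase_add]
    congr 2
    ring
  rw [FbarMat_mulVec, hrecv, Matrix.mulVec_smul, Pi.smul_apply, norm_smul, norm_mul, norm_phase,
    mul_one, mul_pow, Complex.norm_real, Real.norm_eq_abs, sq_abs,
    Real.sq_sqrt (Nat.cast_nonneg _)]

/-- Theorem 1 of the paper: with `ε̃, ε ∈ (−⌊Q/2⌋, Q−⌊Q/2⌋]`, `ε̃ = ε` uniquely maximizes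
the estimation metric for any nonzero channels, under design conditions
(C0) `i_0 < i_1 < ⋯ < i_{N_t−1}`, (C1)–(C2) (training built from all-nonzero base
sequences), and (C3) `N − N_t P ≥ N_t P`, `P ≥ L`, and
`(1_Q − l)ᵀ l^{(q)} > 0` for all `q ∈ {1, …, Q−1}`. -/
theorem stmt0 (Nt Nr P Q L Ng N : ℕ)
    (hNt : 0 < Nt) (hNr : 0 < Nr) (hP : 0 < P) (hQ : 0 < Q) (hL : 0 < L) (hNg : 0 < Ng)
    (hN : N = P * Q) (hLP : L ≤ P) (hC3a : Nt * P ≤ N - Nt * P)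
    (i : Fin Nt → Fin Q) (hi : StrictMono i)
    (hC3b : ∀ q : Fin Q, (q : ℕ) ≠ 0 →
      0 < ∑ k : Fin Q, (1 - pilotLoc Nt Q i k) * pilotLoc Nt Q i (k - q))
    (s : Fin Nt → Fin P → ℂ) (hs : ∀ μ p, s μ p ≠ 0)
    (h : Fin Nr → Fin Nt → Fin L → ℂ) (hh : ∀ ν μ, h ν μ ≠ 0)
    (ε : ℝ) (hε : ε ∈ Set.Ioc (-((Q / 2 : ℕ) : ℝ)) ((Q : ℝ) - ((Q / 2 : ℕ) : ℝ))) :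
    ∀ εt ∈ Set.Ioc (-((Q / 2 : ℕ) : ℝ)) ((Q : ℝ) - ((Q / 2 : ℕ) : ℝ)), εt ≠ ε →
      cfoMetric N P Q Nt Nr L Ng i s h ε εt < cfoMetric N P Q Nt Nr L Ng i s h ε ε := by
  subst hN
  intro εt hεt hne
  have hQ2 : 2 * Nt ≤ Q := by
    have h1 : 0 < Nt * P := Nat.mul_pos hNt hP
    have h2 : P * (2 * Nt) ≤ P * Q := by
      have : P * (2 * Nt) = Nt * P + Nt * P := by ring
      omega
    exact Nat.le_of_mul_le_mul_left h2 hP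
  have hδ' : |ε - εt| < Q := by
    rw [abs_lt]
    constructor <;> linarith [hε.1, hε.2, hεt.1, hεt.2]
  have hPQ : (0 : ℝ) < (P * Q : ℕ) := by exact_mod_cast Nat.mul_pos hP hQ
  simp only [cfoMetric, FbarMat_mulVec_recvVec, ← Finset.mul_sum]
  refine mul_lt_mul_of_pos_left (Finset.sum_lt_sum_of_nonempty
    ⟨⟨0, hNr⟩, Finset.mem_univ _⟩ fun ν _ => ?_) hPQ
  have hnorm : ∀ n : Fin (P * Q), ‖(cfoDiag (P * Q) (ε - εt)).mulVec
      ((dftMatrix (P * Q))ᴴ.mulVec (freqSignal i s (h ν))) n‖ =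
      ‖(dftMatrix (P * Q))ᴴ.mulVec (freqSignal i s (h ν)) n‖ := fun n => by
    rw [cfoDiag_mulVec, norm_mul, norm_phase, one_mul]
  have hid : (cfoDiag (P * Q) (ε - ε)).mulVec
      ((dftMatrix (P * Q))ᴴ.mulVec (freqSignal i s (h ν))) =
      (dftMatrix (P * Q))ᴴ.mulVec (freqSignal i s (h ν)) := by
    ext n
    rw [cfoDiag_mulVec]
    simp [phase]
  have hback : (dftMatrix (P * Q)).mulVec
      ((dftMatrix (P * Q))ᴴ.mulVec (freqSignal i s (h ν))) = freqSignal i s (h ν) := by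
    rw [Matrix.mulVec_mulVec, dftMatrix_mul_conjTranspose, Matrix.one_mulVec]
  have hmax : ∑ j : Fin Nt × Fin P, ‖(dftMatrix (P * Q)).mulVec
      ((cfoDiag (P * Q) (ε - ε)).mulVec
        ((dftMatrix (P * Q))ᴴ.mulVec (freqSignal i s (h ν)))) (pilotIdx i j)‖ ^ 2 =
      ∑ k, ‖(dftMatrix (P * Q)).mulVec ((cfoDiag (P * Q) (ε - εt)).mulVec
        ((dftMatrix (P * Q))ᴴ.mulVec (freqSignal i s (h ν)))) k‖ ^ 2 := by
    rw [sum_norm_sq_dftMatrix_mulVec]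
    simp_rw [hnorm]
    rw [← sum_norm_sq_dftMatrix_mulVec, hid, hback]
    exact Fintype.sum_of_injective (pilotIdx i) (pilotIdx_injective hi.injective) _ _
      (fun k hk => by simp [freqSignal_eq_zero i s (h ν) k hk]) fun _ => rfl
  obtain ⟨k, hk, hk0⟩ := exists_leakage hNt hP hQ2 hLP hi.injective hC3b s hs (h ν) (hh ν)
    (ε - εt) (sub_ne_zero.2 hne.symm) hδ'
  rw [hmax, ← Finset.sum_image (s := Finset.univ) (g := pilotIdx i)
    (f := fun k => ‖(dftMatrix (P * Q)).mulVec ((cfoDiag (P * Q) (ε - εt)).mulVec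
      ((dftMatrix (P * Q))ᴴ.mulVec (freqSignal i s (h ν)))) k‖ ^ 2)
    (pilotIdx_injective hi.injective).injOn]
  refine Finset.sum_lt_sum_of_subset (Finset.subset_univ _) (Finset.mem_univ k) ?_
    (pow_pos (norm_pos_iff.2 hk0) 2) fun _ _ _ => sq_nonneg _
  simpa using hk

end
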